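/- arXiv:2405.16663 — 4 statements merged into one kernel-verified Lean document; each statement's English description precedes it below -/
import Mathlib

section
/- Let n ∈ ℕ, let Q ∈ [0,1]^{n×n} be a symmetric matrix with zero diagonal, and let d ≥ 5 satisfy Q_ij ≤ d/n for all i,j. Let A be a random graph drawn from G(n,Q). Then for every t ∈ [2e², log n], the probability that A has at least e^{−t}·n nodes of degree at least t·d is at most exp(−t·e^{−t}·n·d/4). -/
open scoped BigOperators Classical

namespace EdgeDensity

/-- A graph on `n` nodes, identified with its Boolean adjacency function:
symmetric with no self-loops. -/
def IsGraph {n : ℕ} (A : Fin n → Fin n → Bool) : Prop :=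
  (∀ i j, A i j = A j i) ∧ ∀ i, A i i = false

/-- The real adjacency matrix of a Boolean graph. -/
def adjMat {n : ℕ} (A : Fin n → Fin n → Bool) : Matrix (Fin n) (Fin n) ℝ :=
  Matrix.of fun i j => if A i j then 1 else 0

/-- `d(M) = (1/n) ∑_{i,j} M i j`, the average row sum. -/
noncomputable def dbar {n : ℕ} (M : Matrix (Fin n) (Fin n) ℝ) : ℝ :=
  (∑ i, ∑ j, M i j) / n

/-- `(M 𝟙)_i = ∑_j M i j`, the `i`-th row sum (degree of node `i`). -/
def rowSum {n : ℕ} (M : Matrix (Fin n) (Fin n) ℝ) (i : Fin n) : ℝ := ∑ j, M i j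

/-- The probability that the inhomogeneous random graph `G(n,Q)` equals the
given graph `A`: each edge `{i,j}` with `i < j` is present independently with
probability `Q i j`. -/
noncomputable def erWeight {n : ℕ} (Q : Matrix (Fin n) (Fin n) ℝ)
    (A : Fin n → Fin n → Bool) : ℝ :=
  ∏ i, ∏ j ∈ Finset.univ.filter (fun j => i < j),
    (if A i j then Q i j else 1 - Q i j)

/-- Probability of the event `E` under the inhomogeneous random graph `G(n,Q)`. -/
noncomputable def erProb {n : ℕ} (Q : Matrix (Fin n) (Fin n) ℝ)
    (E : (Fin n → Fin n → Bool) → Prop) : ℝ :=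
  ∑ A ∈ Finset.univ.filter (fun A => IsGraph A ∧ E A), erWeight Q A

/-- Node distance between two graphs: the minimum cardinality of a set `S` of
nodes such that the two adjacency matrices agree on all entries `(i,j)` with
`i ∉ S` and `j ∉ S`. -/
noncomputable def nodeDist {n : ℕ} (A B : Fin n → Fin n → Bool) : ℕ :=
  sInf {k | ∃ S : Finset (Fin n), S.card = k ∧
    ∀ i j, i ∉ S → j ∉ S → A i j = B i j}

/-- The feasibility constraints `P1(A, γ)` on a pair `(Y, z)`. -/
def P1 {n : ℕ} (A : Matrix (Fin n) (Fin n) ℝ) (γ : ℝ)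
    (Y : Matrix (Fin n) (Fin n) ℝ) (z : Fin n → ℝ) : Prop :=
  (∀ i, z i = 0 ∨ z i = 1) ∧
  ((1 - γ) * n ≤ ∑ i, z i) ∧
  (∀ i j, Y i j = Y j i) ∧
  (∀ i j, 0 ≤ Y i j ∧ Y i j ≤ 1) ∧
  (∀ i j, Y i j * z i * z j = A i j * z i * z j)

/-- The binomial probability mass function `Bin(n,p)` at `k`. -/
noncomputable def binomPMF (n : ℕ) (p : ℝ) (k : ℕ) : ℝ :=
  (n.choose k : ℝ) * p ^ k * (1 - p) ^ (n - k)

/-- Total variation distance between `Bin(n,p)` and `Bin(n,q)`. -/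
noncomputable def binomTV (n : ℕ) (p q : ℝ) : ℝ :=
  (∑ k ∈ Finset.range (n + 1), |binomPMF n p k - binomPMF n q k|) / 2

/-- The spectral norm (largest singular value) of a real square matrix. -/
noncomputable def specNorm {n : ℕ} (M : Matrix (Fin n) (Fin n) ℝ) : ℝ :=
  ‖LinearMap.toContinuousLinearMap (Matrix.toEuclideanLin M)‖

/-- A randomized algorithm on `n`-node graphs is `ε`-differentially
node-private. -/
def IsNodeDP {n : ℕ} (ε : ℝ)
    (𝒜 : (Fin n → Fin n → Bool) → MeasureTheory.Measure ℝ) : Prop :=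
  ∀ G G', IsGraph G → IsGraph G' → nodeDist G G' ≤ 1 →
    ∀ S : Set ℝ, MeasurableSet S →
      𝒜 G S ≤ ENNReal.ofReal (Real.exp ε) * 𝒜 G' S

/-- `Pr_{G ~ G(n,Q), 𝒜}[𝒜(G) ∈ S]`. -/
noncomputable def algProb {n : ℕ} (Q : Matrix (Fin n) (Fin n) ℝ)
    (𝒜 : (Fin n → Fin n → Bool) → MeasureTheory.Measure ℝ) (S : Set ℝ) : ℝ :=
  ∑ A ∈ Finset.univ.filter (fun A => IsGraph A), erWeight Q A * (𝒜 A S).toReal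


/-- A sum over graphs of a product over pairs `i < j` is at most the product of the sums over the
two states of each pair. -/
lemma sum_isGraph_prod_le {n : ℕ} (w : {p : Fin n × Fin n // p.1 < p.2} → Bool → ℝ)
    (hw : ∀ p b, 0 ≤ w p b) :
    ∑ A ∈ Finset.univ.filter (fun A : Fin n → Fin n → Bool => IsGraph A),
      ∏ p, w p (A p.1.1 p.1.2) ≤ ∏ p, (w p true + w p false) := by
  have hinj : Set.InjOn (fun (A : Fin n → Fin n → Bool)
      (p : {p : Fin n × Fin n // p.1 < p.2}) => A p.1.1 p.1.2)
      (Finset.univ.filter (fun A : Fin n → Fin n → Bool => IsGraph A)) := by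
    intro A hA B hB h
    simp only [Finset.coe_filter, Finset.mem_univ, true_and, Set.mem_ofPred_eq] at hA hB
    have key : ∀ i j, i < j → A i j = B i j := fun i j hij => congrFun h ⟨(i, j), hij⟩
    ext1 i
    ext1 j
    rcases lt_trichotomy i j with hij | rfl | hij
    · exact key i j hij
    · rw [hA.2, hB.2]
    · rw [hA.1, hB.1, key j i hij]
  rw [← Finset.sum_image (g := fun (A : Fin n → Fin n → Bool)
      (p : {p : Fin n × Fin n // p.1 < p.2}) => A p.1.1 p.1.2)
      (f := fun F => ∏ p, w p (F p)) hinj]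
  calc _ ≤ ∑ F : {p : Fin n × Fin n // p.1 < p.2} → Bool, ∏ p, w p (F p) :=
        Finset.sum_le_sum_of_subset_of_nonneg (Finset.subset_univ _)
          fun F _ _ => Finset.prod_nonneg fun p _ => hw p _
    _ = ∏ p, ∑ b, w p b := (Fintype.prod_sum w).symm
    _ = _ := by simp

lemma erWeight_eq_prod_subtype {n : ℕ} (Q : Matrix (Fin n) (Fin n) ℝ)
    (A : Fin n → Fin n → Bool) :
    erWeight Q A = ∏ p : {p : Fin n × Fin n // p.1 < p.2},
      if A p.1.1 p.1.2 then Q p.1.1 p.1.2 else 1 - Q p.1.1 p.1.2 := by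
  rw [← Finset.prod_subtype (Finset.univ.filter fun p : Fin n × Fin n => p.1 < p.2)
    (by simp) (fun p => if A p.1 p.2 then Q p.1 p.2 else 1 - Q p.1 p.2)]
  simp only [erWeight, Finset.prod_filter, Fintype.prod_prod_type]

lemma erWeight_nonneg {n : ℕ} {Q : Matrix (Fin n) (Fin n) ℝ}
    (hrange : ∀ i j, 0 ≤ Q i j ∧ Q i j ≤ 1) (A : Fin n → Fin n → Bool) : 0 ≤ erWeight Q A := by
  refine Finset.prod_nonneg fun i _ => Finset.prod_nonneg fun j _ => ?_
  split_ifs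
  · exact (hrange i j).1
  · linarith [(hrange i j).2]

/-- For a symmetric matrix with zero diagonal, the total row sum over `S` counts each pair `i < j`
once for each endpoint in `S`. -/
lemma sum_rowSum_eq_sum_pairs {n : ℕ} (M : Matrix (Fin n) (Fin n) ℝ)
    (hsym : ∀ i j, M i j = M j i) (hdiag : ∀ i, M i i = 0) (S : Finset (Fin n)) :
    ∑ i ∈ S, rowSum M i = ∑ p : {p : Fin n × Fin n // p.1 < p.2},
      M p.1.1 p.1.2 * ((if p.1.1 ∈ S then 1 else 0) + if p.1.2 ∈ S then 1 else 0) := by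
  rw [← Finset.sum_subtype (Finset.univ.filter fun p : Fin n × Fin n => p.1 < p.2)
    (by simp) (fun p => M p.1 p.2 * ((if p.1 ∈ S then 1 else 0) + if p.2 ∈ S then 1 else 0))]
  simp only [Finset.sum_filter, Fintype.sum_prod_type]
  have hsplit : ∀ i j, (if i < j then
      M i j * ((if i ∈ S then 1 else 0) + if j ∈ S then 1 else 0) else 0) =
      (if i < j then if i ∈ S then M i j else 0 else 0) +
        (if i < j then if j ∈ S then M j i else 0 else 0) := by
    intro i j
    rw [hsym j i]
    split_ifs <;> ring
  simp only [hsplit, Finset.sum_add_distrib]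
  rw [Finset.sum_comm (f := fun i j => if i < j then if j ∈ S then M j i else 0 else 0),
    ← Finset.sum_add_distrib, ← Finset.sum_subset (Finset.subset_univ S)
      fun i _ hi => by simp [hi]]
  refine Finset.sum_congr rfl fun i hi => ?_
  rw [rowSum, ← Finset.sum_add_distrib]
  refine Finset.sum_congr rfl fun j _ => ?_
  rcases lt_trichotomy i j with hij | rfl | hij
  · simp [hi, hij, hij.not_gt]
  · simp [hdiag]
  · simp [hi, hij, hij.not_gt]

/-- Exponential moment bound for the total degree of a set of nodes. -/
lemma sum_erWeight_mul_exp_le {n : ℕ} (Q : Matrix (Fin n) (Fin n) ℝ)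
    (hsym : ∀ i j, Q i j = Q j i) (hdiag : ∀ i, Q i i = 0)
    (hrange : ∀ i j, 0 ≤ Q i j ∧ Q i j ≤ 1) (S : Finset (Fin n)) :
    ∑ A ∈ Finset.univ.filter (fun A : Fin n → Fin n → Bool => IsGraph A),
      erWeight Q A * Real.exp (∑ i ∈ S, rowSum (adjMat A) i) ≤
    Real.exp ((Real.exp 2 - 1) / 2 * ∑ i ∈ S, rowSum Q i) := by
  set c : {p : Fin n × Fin n // p.1 < p.2} → ℝ := fun p =>
    (if p.1.1 ∈ S then 1 else 0) + if p.1.2 ∈ S then 1 else 0 with hc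
  set w : {p : Fin n × Fin n // p.1 < p.2} → Bool → ℝ := fun p b =>
    if b then Q p.1.1 p.1.2 * Real.exp (c p) else 1 - Q p.1.1 p.1.2 with hw
  have hexp : ∀ p, Real.exp (c p) - 1 ≤ (Real.exp 2 - 1) / 2 * c p := by
    intro p
    have h2 : Real.exp 2 = Real.exp 1 ^ 2 := by rw [← Real.exp_nat_mul]; norm_num
    simp only [hc]
    split_ifs
    · norm_num
    · norm_num
      nlinarith [sq_nonneg (Real.exp 1 - 1)]
    · norm_num
      nlinarith [sq_nonneg (Real.exp 1 - 1)]
    · norm_num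
  calc _ = ∑ A ∈ Finset.univ.filter (fun A : Fin n → Fin n → Bool => IsGraph A),
        ∏ p, w p (A p.1.1 p.1.2) := by
        refine Finset.sum_congr rfl fun A hA => ?_
        have hA : IsGraph A := (Finset.mem_filter.1 hA).2
        rw [sum_rowSum_eq_sum_pairs (adjMat A) (fun i j => by simp [adjMat, hA.1 i j])
          (fun i => by simp [adjMat, hA.2 i]), erWeight_eq_prod_subtype, Real.exp_sum,
          ← Finset.prod_mul_distrib]
        refine Finset.prod_congr rfl fun p _ => ?_
        cases h : A p.1.1 p.1.2 <;> simp [hw, hc, adjMat, h]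
    _ ≤ ∏ p, (w p true + w p false) := by
        refine sum_isGraph_prod_le w fun p b => ?_
        have := hrange p.1.1 p.1.2
        cases b
        · simpa [hw] using this.2
        · simpa [hw] using mul_nonneg this.1 (Real.exp_pos _).le
    _ ≤ ∏ p, Real.exp ((Real.exp 2 - 1) / 2 * (Q p.1.1 p.1.2 * c p)) := by
        refine Finset.prod_le_prod (fun p _ => ?_) fun p _ => ?_
        · have := hrange p.1.1 p.1.2
          have := mul_nonneg this.1 (Real.exp_pos (c p)).le
          simp only [hw, if_true, Bool.false_eq_true, if_false]
          linarith
        · have h0 := mul_le_mul_of_nonneg_left (hexp p) (hrange p.1.1 p.1.2).1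
          have h1 := Real.add_one_le_exp ((Real.exp 2 - 1) / 2 * (Q p.1.1 p.1.2 * c p))
          simp only [hw, if_true, Bool.false_eq_true, if_false]
          linarith
    _ = _ := by rw [← Real.exp_sum, sum_rowSum_eq_sum_pairs Q hsym hdiag, Finset.mul_sum]

/-- degree distribution of inhomogeneous random graphs. -/
theorem degree_distribution (n : ℕ) (Q : Matrix (Fin n) (Fin n) ℝ)
    (hsym : ∀ i j, Q i j = Q j i) (hdiag : ∀ i, Q i i = 0)
    (hrange : ∀ i j, 0 ≤ Q i j ∧ Q i j ≤ 1)
    (d : ℝ) (hd : 5 ≤ d) (hQd : ∀ i j, Q i j ≤ d / n)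
    (t : ℝ) (ht1 : 2 * Real.exp 2 ≤ t) (ht2 : t ≤ Real.log n) :
    erProb Q (fun A =>
        Real.exp (-t) * n ≤
          ((Finset.univ.filter fun i => t * d ≤ rowSum (adjMat A) i).card : ℝ)) ≤
      Real.exp (-(t * Real.exp (-t) * n * d) / 4) := by
  set y : ℝ := Real.exp (t * d / 2) with hy
  set κ : ℝ := (Real.exp 2 - 1) / 2 with hκ
  set G := Finset.univ.filter (fun A : Fin n → Fin n → Bool => IsGraph A) with hG
  have hE : 1 ≤ Real.exp 2 := Real.one_le_exp (by norm_num)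
  have ht : 2 ≤ t := by linarith
  have hrow : ∀ i, rowSum Q i ≤ d := by
    intro i
    have hn : (n : ℝ) ≠ 0 := by
      have := i.pos
      positivity
    calc rowSum Q i ≤ ∑ _j : Fin n, d / n := Finset.sum_le_sum fun j _ => hQd i j
      _ = d := by simp; field_simp
  have hmoment : ∑ A ∈ G, erWeight Q A *
      ∏ i, (1 + y * Real.exp (rowSum (adjMat A) i - t * d)) ≤
      (1 + y * Real.exp (κ * d - t * d)) ^ n := by
    calc _ = ∑ S : Finset (Fin n), (y * Real.exp (-(t * d))) ^ S.card *
          ∑ A ∈ G, erWeight Q A * Real.exp (∑ i ∈ S, rowSum (adjMat A) i) := by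
          simp only [Finset.prod_one_add, Finset.powerset_univ, Finset.mul_sum]
          rw [Finset.sum_comm]
          refine Finset.sum_congr rfl fun S _ => Finset.sum_congr rfl fun A _ => ?_
          rw [Real.exp_sum, ← Finset.prod_const, mul_left_comm, ← Finset.prod_mul_distrib]
          congr 1
          refine Finset.prod_congr rfl fun i _ => ?_
          rw [sub_eq_add_neg, Real.exp_add]
          ring
      _ ≤ ∑ S : Finset (Fin n), ∏ _i ∈ S, (y * Real.exp (κ * d - t * d)) := by
          refine Finset.sum_le_sum fun S _ => ?_
          have hS : ∑ i ∈ S, rowSum Q i ≤ S.card * d := by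
            simpa using Finset.sum_le_sum (s := S) fun i _ => hrow i
          calc _ ≤ (y * Real.exp (-(t * d))) ^ S.card * Real.exp (κ * (S.card * d)) := by
                refine mul_le_mul_of_nonneg_left
                  ((sum_erWeight_mul_exp_le Q hsym hdiag hrange S).trans ?_) (by positivity)
                exact Real.exp_le_exp.2 (mul_le_mul_of_nonneg_left hS (by linarith))
            _ = _ := by
                rw [Finset.prod_const, mul_left_comm κ, Real.exp_nat_mul, ← mul_pow, mul_assoc,
                  ← Real.exp_add]
                ring_nf
      _ = _ := by
          rw [← Finset.powerset_univ, ← Finset.prod_one_add]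
          simp
  have hevent : erProb Q (fun A => Real.exp (-t) * n ≤
        ((Finset.univ.filter fun i => t * d ≤ rowSum (adjMat A) i).card : ℝ)) *
      Real.exp (t * d / 2 * (Real.exp (-t) * n)) ≤
      ∑ A ∈ G, erWeight Q A * ∏ i, (1 + y * Real.exp (rowSum (adjMat A) i - t * d)) := by
    rw [erProb, Finset.sum_mul]
    calc _ ≤ ∑ A ∈ Finset.univ.filter (fun A => IsGraph A ∧ Real.exp (-t) * n ≤
          ((Finset.univ.filter fun i => t * d ≤ rowSum (adjMat A) i).card : ℝ)), erWeight Q A *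
            ∏ i, (1 + y * Real.exp (rowSum (adjMat A) i - t * d)) := by
          refine Finset.sum_le_sum fun A hA => ?_
          have hA := (Finset.mem_filter.1 hA).2.2
          refine mul_le_mul_of_nonneg_left ?_ (erWeight_nonneg hrange A)
          calc _ ≤ Real.exp (t * d / 2 *
                ((Finset.univ.filter fun i => t * d ≤ rowSum (adjMat A) i).card : ℝ)) :=
                Real.exp_le_exp.2 (mul_le_mul_of_nonneg_left hA (by positivity))
            _ = ∏ i, if t * d ≤ rowSum (adjMat A) i then y else 1 := by
                rw [← Finset.prod_filter, Finset.prod_const, mul_comm, Real.exp_nat_mul]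
            _ ≤ _ := by
                refine Finset.prod_le_prod (fun i _ => by split_ifs <;> positivity) fun i _ => ?_
                split_ifs with h
                · have : 1 ≤ Real.exp (rowSum (adjMat A) i - t * d) :=
                    Real.one_le_exp (by linarith)
                  nlinarith [Real.exp_pos (t * d / 2)]
                · have : 0 ≤ y * Real.exp (rowSum (adjMat A) i - t * d) := by positivity
                  linarith
      _ ≤ _ := by
          refine Finset.sum_le_sum_of_subset_of_nonneg ?_ fun A _ _ =>
            mul_nonneg (erWeight_nonneg hrange A) (Finset.prod_nonneg fun i _ => by positivity)
          intro A hA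
          exact Finset.mem_filter.2 ⟨Finset.mem_univ _, (Finset.mem_filter.1 hA).2.1⟩
  have hpow : (1 + y * Real.exp (κ * d - t * d)) ^ n ≤ Real.exp (Real.exp (-t) * n) := by
    have hle : y * Real.exp (κ * d - t * d) ≤ Real.exp (-t) := by
      rw [hy, ← Real.exp_add]
      refine Real.exp_le_exp.2 ?_
      have h1 : t * 5 ≤ t * d := mul_le_mul_of_nonneg_left hd (by linarith)
      have h2 : κ * d ≤ 3 / 10 * t * d := mul_le_mul_of_nonneg_right (by linarith) (by linarith)
      linarith
    rw [mul_comm (Real.exp (-t)), Real.exp_nat_mul]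
    refine pow_le_pow_left₀ (by positivity) ?_ n
    linarith [Real.add_one_le_exp (Real.exp (-t))]
  refine le_of_mul_le_mul_right ((hevent.trans hmoment).trans (hpow.trans ?_))
    (Real.exp_pos (t * d / 2 * (Real.exp (-t) * n)))
  rw [← Real.exp_add]
  refine Real.exp_le_exp.2 ?_
  have htd : 4 ≤ t * d := by nlinarith
  have ha : 0 ≤ Real.exp (-t) * n := by positivity
  nlinarith [mul_le_mul_of_nonneg_right htd ha]

end EdgeDensity
end

section
/- Let n ∈ ℕ, p° ∈ [0,1], α ∈ [0,1/2], let p' := (1−2α)·p°, and let Δ := TV(Bin(n,p°), Bin(n,p')). Then there exist a coupling ω of the graph distributions G(n,p°) and G(n,p') and, on the same probability space, a random variable X distributed as Bin(n,Δ) such that for (G,G') ~ ω one has dist(G,G') ≤ X almost surely. Moreover, there exist absolute constants c, c', C > 0 such that if p° ≤ c and α ≤ c'/√(n·p°), then Δ ≤ C·α·√(n·p°). -/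
open scoped BigOperators Classical

namespace EdgeDensity

/-- The Bernoulli weight of a bit. -/
noncomputable def bitWeight (p : ℝ) (b : Bool) : ℝ := if b then p else 1 - p

/-- The product Bernoulli weight of a bit vector. -/
noncomputable def vecWeight {n : ℕ} (p : ℝ) (v : Fin n → Bool) : ℝ := ∏ j, bitWeight p (v j)

/-- The graph obtained from the entries strictly above the diagonal. -/
def upperGraph {n : ℕ} (x : Fin n → Fin n → Bool) (i j : Fin n) : Bool :=
  if i < j then x i j else if j < i then x j i else false

/-- The maximal coupling of two weight functions. -/
noncomputable def maxCoupling {V : Type*} [Fintype V] (a b : V → ℝ) (w : V × V) : ℝ :=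
  (if w.1 = w.2 then min (a w.1) (b w.1) else 0) +
    (a w.1 - min (a w.1) (b w.1)) * (b w.2 - min (a w.2) (b w.2)) / ((∑ v, |a v - b v|) / 2)

theorem sum_pi_ite_prod {ι α : Type*} [Fintype ι] [DecidableEq ι] [Fintype α] (R : ι → α → Prop) (h : ι → α → ℝ) :
    (∑ f : ι → α, if ∀ i, R i (f i) then ∏ i, h i (f i) else 0) =
      ∏ i, ∑ a, if R i a then h i a else 0 := by
  rw [Finset.prod_univ_sum, Fintype.piFinset_univ]
  refine Finset.sum_congr rfl fun f _ => ?_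
  rw [Finset.prod_ite_zero]
  simp

section MaxCoupling

variable {V : Type*} [Fintype V] {a b : V → ℝ}

theorem maxCoupling_nonneg (ha : ∀ v, 0 ≤ a v) (hb : ∀ v, 0 ≤ b v) (w : V × V) :
    0 ≤ maxCoupling a b w := by
  unfold maxCoupling
  refine add_nonneg ?_ (div_nonneg (mul_nonneg ?_ ?_) ?_)
  · split_ifs
    · exact le_min (ha _) (hb _)
    · exact le_rfl
  · exact sub_nonneg.2 (min_le_left _ _)
  · exact sub_nonneg.2 (min_le_right _ _)
  · exact div_nonneg (Finset.sum_nonneg fun _ _ => abs_nonneg _) (by norm_num)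

theorem sum_left_sub_min (hab : ∑ v, a v = ∑ v, b v) :
    ∑ v, (a v - min (a v) (b v)) = (∑ v, |a v - b v|) / 2 := by
  have h : ∀ v, a v - min (a v) (b v) = (|a v - b v| + (a v - b v)) / 2 := by
    intro v
    rcases le_total (a v) (b v) with h | h
    · rw [min_eq_left h, abs_of_nonpos (by linarith)]; ring
    · rw [min_eq_right h, abs_of_nonneg (by linarith)]; ring
  rw [Finset.sum_congr rfl fun v _ => h v, ← Finset.sum_div, Finset.sum_add_distrib,
    Finset.sum_sub_distrib, hab]
  ring

theorem sum_right_sub_min (hab : ∑ v, a v = ∑ v, b v) :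
    ∑ v, (b v - min (a v) (b v)) = (∑ v, |a v - b v|) / 2 := by
  have h := sum_left_sub_min hab.symm
  simpa only [min_comm, abs_sub_comm] using h

theorem eq_of_sum_abs_sub_eq_zero (h : (∑ v, |a v - b v|) / 2 = 0) (v : V) : a v = b v := by
  have h0 : ∑ v, |a v - b v| = 0 := by linarith
  have h1 := (Finset.sum_eq_zero_iff_of_nonneg fun _ _ => abs_nonneg _).1 h0 v (Finset.mem_univ v)
  exact sub_eq_zero.1 (abs_eq_zero.1 h1)

theorem sum_maxCoupling_right (hab : ∑ v, a v = ∑ v, b v) (v : V) :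
    ∑ w, maxCoupling a b (v, w) = a v := by
  simp only [maxCoupling, Finset.sum_add_distrib, Finset.sum_ite_eq, Finset.mem_univ, if_true]
  rw [← Finset.sum_div, ← Finset.mul_sum, sum_right_sub_min hab]
  by_cases h : (∑ v, |a v - b v|) / 2 = 0
  · rw [h, eq_of_sum_abs_sub_eq_zero h v]; simp
  · rw [mul_div_cancel_right₀ _ h]; ring

theorem sum_maxCoupling_left (hab : ∑ v, a v = ∑ v, b v) (w : V) :
    ∑ v, maxCoupling a b (v, w) = b w := by
  simp only [maxCoupling, Finset.sum_add_distrib, Finset.sum_ite_eq', Finset.mem_univ, if_true]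
  rw [← Finset.sum_div, ← Finset.sum_mul, sum_left_sub_min hab]
  by_cases h : (∑ v, |a v - b v|) / 2 = 0
  · rw [h, eq_of_sum_abs_sub_eq_zero h w]; simp
  · rw [mul_div_cancel_left₀ _ h]; ring

theorem maxCoupling_diag (v : V) : maxCoupling a b (v, v) = min (a v) (b v) := by
  have h : (a v - min (a v) (b v)) * (b v - min (a v) (b v)) = 0 := by
    rcases le_total (a v) (b v) with h | h
    · rw [min_eq_left h]; ring
    · rw [min_eq_right h]; ring
  simp [maxCoupling, h]

theorem sum_maxCoupling_eq [DecidableEq V] (ha : ∑ v, a v = 1) (hb : ∑ v, b v = 1) :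
    (∑ w : V × V, if w.1 = w.2 then maxCoupling a b w else 0) =
      1 - (∑ v, |a v - b v|) / 2 := by
  rw [Fintype.sum_prod_type]
  simp only [Finset.sum_ite_eq, Finset.mem_univ, if_true, maxCoupling_diag]
  have h := sum_left_sub_min (ha.trans hb.symm)
  rw [Finset.sum_sub_distrib, ha] at h
  linarith

theorem sum_maxCoupling_ne [DecidableEq V] (ha : ∑ v, a v = 1) (hb : ∑ v, b v = 1) :
    (∑ w : V × V, if w.1 ≠ w.2 then maxCoupling a b w else 0) = (∑ v, |a v - b v|) / 2 := by
  have h : (∑ w : V × V, if w.1 ≠ w.2 then maxCoupling a b w else 0) +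
      (∑ w : V × V, if w.1 = w.2 then maxCoupling a b w else 0) = 1 := by
    rw [← Finset.sum_add_distrib, ← ha, Fintype.sum_prod_type]
    refine Finset.sum_congr rfl fun v _ => ?_
    rw [← sum_maxCoupling_right (ha.trans hb.symm) v]
    refine Finset.sum_congr rfl fun w _ => ?_
    by_cases h : v = w <;> simp [h]
  rw [sum_maxCoupling_eq ha hb] at h
  linarith

end MaxCoupling

theorem sum_bitWeight (p : ℝ) : ∑ b, bitWeight p b = 1 := by
  simp [bitWeight]

theorem vecWeight_nonneg {n : ℕ} {p : ℝ} (h0 : 0 ≤ p) (h1 : p ≤ 1) (v : Fin n → Bool) :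
    0 ≤ vecWeight p v := by
  refine Finset.prod_nonneg fun j _ => ?_
  unfold bitWeight
  split_ifs <;> linarith

theorem sum_vecWeight_ite {n : ℕ} (p : ℝ) (R : Fin n → Bool → Prop) :
    (∑ v : Fin n → Bool, if ∀ j, R j (v j) then vecWeight p v else 0) =
      ∏ j, ∑ b, if R j b then bitWeight p b else 0 := by
  unfold vecWeight
  convert sum_pi_ite_prod R fun _ b => bitWeight p b

theorem sum_vecWeight (n : ℕ) (p : ℝ) : ∑ v : Fin n → Bool, vecWeight p v = 1 := by
  have h := sum_vecWeight_ite (n := n) p fun _ _ => True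
  simpa only [implies_true, if_true, sum_bitWeight, Finset.prod_const_one] using h

theorem vecWeight_eq {n : ℕ} (p : ℝ) (v : Fin n → Bool) :
    vecWeight p v = p ^ (Finset.univ.filter fun j => v j = true).card *
      (1 - p) ^ (n - (Finset.univ.filter fun j => v j = true).card) := by
  have h := Finset.card_filter_add_card_filter_not (s := (Finset.univ : Finset (Fin n)))
    (fun j => v j = true)
  rw [Finset.card_univ, Fintype.card_fin] at h
  simp only [vecWeight, bitWeight]
  rw [Finset.prod_ite, Finset.prod_const, Finset.prod_const]
  congr 2
  omega

theorem sum_abs_vecWeight_sub (n : ℕ) (p q : ℝ) :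
    (∑ v : Fin n → Bool, |vecWeight p v - vecWeight q v|) / 2 = binomTV n p q := by
  unfold binomTV
  congr 1
  let e : (Fin n → Bool) ≃ Finset (Fin n) :=
    { toFun := fun v => Finset.univ.filter fun j => v j = true
      invFun := fun s j => decide (j ∈ s)
      left_inv := fun v => by ext j; simp
      right_inv := fun s => by ext j; simp }
  let F : ℕ → ℝ := fun k => |p ^ k * (1 - p) ^ (n - k) - q ^ k * (1 - q) ^ (n - k)|
  have h1 : ∑ v : Fin n → Bool, |vecWeight p v - vecWeight q v| =
      ∑ s : Finset (Fin n), F s.card := by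
    refine Fintype.sum_equiv e _ _ fun v => ?_
    simp only [vecWeight_eq, F, e, Equiv.coe_fn_mk]
  rw [h1, ← Finset.powerset_univ, Finset.sum_powerset_apply_card, Finset.card_univ,
    Fintype.card_fin]
  refine Finset.sum_congr rfl fun k _ => ?_
  simp only [F, binomPMF, nsmul_eq_mul]
  rw [← abs_of_nonneg (Nat.cast_nonneg (α := ℝ) (n.choose k)), ← abs_mul,
    abs_of_nonneg (Nat.cast_nonneg (α := ℝ) (n.choose k))]
  congr 1
  ring

theorem isGraph_upperGraph {n : ℕ} (x : Fin n → Fin n → Bool) : IsGraph (upperGraph x) := by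
  refine ⟨fun i j => ?_, fun i => by simp [upperGraph]⟩
  unfold upperGraph
  rcases lt_trichotomy i j with h | h | h
  · simp [h, h.not_gt]
  · simp [h]
  · simp [h, h.not_gt]

theorem upperGraph_eq_iff {n : ℕ} {G : Fin n → Fin n → Bool} (hG : IsGraph G)
    (x : Fin n → Fin n → Bool) :
    upperGraph x = G ↔ ∀ i j, i < j → x i j = G i j := by
  constructor
  · rintro rfl i j h
    simp [upperGraph, h]
  · intro h
    ext1 i
    ext1 j
    unfold upperGraph
    rcases lt_trichotomy i j with hij | hij | hij
    · simp [hij, h i j hij]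
    · simp [hij, hG.2 j]
    · simp [hij, hij.not_gt, h j i hij, hG.1 i j]

theorem sum_upperGraph_eq {n : ℕ} (p : ℝ) (G : Fin n → Fin n → Bool) :
    (∑ x : Fin n → Fin n → Bool, if upperGraph x = G then ∏ i, vecWeight p (x i) else 0) =
      if IsGraph G then erWeight (Matrix.of fun _ _ => p) G else 0 := by
  split_ifs with hG
  · simp only [upperGraph_eq_iff hG]
    refine Eq.trans (by congr!)
      ((sum_pi_ite_prod (fun i v => ∀ j, i < j → v j = G i j) fun _ v => vecWeight p v).trans ?_)
    unfold erWeight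
    refine Finset.prod_congr rfl fun i _ => ?_
    refine Eq.trans (by congr!) ((sum_vecWeight_ite p fun j b => i < j → b = G i j).trans ?_)
    rw [Finset.prod_filter]
    refine Finset.prod_congr rfl fun j _ => ?_
    by_cases h : i < j
    · simp [h, bitWeight]
    · simp only [h, false_imp_iff, if_true, if_false, sum_bitWeight]
  · refine Finset.sum_eq_zero fun x _ => if_neg ?_
    rintro rfl
    exact hG (isGraph_upperGraph x)

theorem nodeDist_upperGraph_le {n : ℕ} (x y : Fin n → Fin n → Bool) :
    nodeDist (upperGraph x) (upperGraph y) ≤ (Finset.univ.filter fun i => x i ≠ y i).card := by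
  refine Nat.sInf_le ⟨_, rfl, fun i j hi hj => ?_⟩
  simp only [Finset.mem_filter, Finset.mem_univ, true_and, not_not] at hi hj
  simp only [upperGraph, hi, hj]

theorem sum_prod_fst {ι V : Type*} [Fintype ι] [DecidableEq ι] [Fintype V] {κ : V × V → ℝ} {a : V → ℝ}
    (h : ∀ v, ∑ w, κ (v, w) = a v) (Q : (ι → V) → Prop) [DecidablePred Q] :
    (∑ z : ι → V × V, if Q (fun i => (z i).1) then ∏ i, κ (z i) else 0) =
      ∑ x : ι → V, if Q x then ∏ i, a (x i) else 0 := by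
  have key : ∀ x : ι → V, (∏ i, a (x i)) =
      ∑ z : ι → V × V, if ∀ i, (z i).1 = x i then ∏ i, κ (z i) else 0 := by
    intro x
    rw [sum_pi_ite_prod (fun i w => w.1 = x i) fun _ w => κ w]
    refine Finset.prod_congr rfl fun i _ => ?_
    rw [Fintype.sum_prod_type_right]
    simp [h]
  simp only [key, ← Finset.sum_filter (p := Q)]
  rw [Finset.sum_comm]
  refine Finset.sum_congr rfl fun z _ => ?_
  simp only [← funext_iff]
  rw [Finset.sum_ite_eq]
  simp

theorem sum_prod_snd {ι V : Type*} [Fintype ι] [DecidableEq ι] [Fintype V] {κ : V × V → ℝ} {b : V → ℝ}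
    (h : ∀ w, ∑ v, κ (v, w) = b w) (Q : (ι → V) → Prop) [DecidablePred Q] :
    (∑ z : ι → V × V, if Q (fun i => (z i).2) then ∏ i, κ (z i) else 0) =
      ∑ x : ι → V, if Q x then ∏ i, b (x i) else 0 := by
  rw [← sum_prod_fst (κ := fun w => κ w.swap) h Q]
  exact Fintype.sum_equiv (Equiv.piCongrRight fun _ => Equiv.prodComm V V) _ _ fun z => rfl

theorem sum_prod_card_ne {n : ℕ} {V : Type*} [Fintype V] [DecidableEq V] {κ : V × V → ℝ} {d : ℝ}
    (h1 : (∑ w : V × V, if w.1 = w.2 then κ w else 0) = 1 - d)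
    (h2 : (∑ w : V × V, if w.1 ≠ w.2 then κ w else 0) = d) (k : ℕ) :
    (∑ z : Fin n → V × V, if (Finset.univ.filter fun i => (z i).1 ≠ (z i).2).card = k
      then ∏ i, κ (z i) else 0) = binomPMF n d k := by
  have key : ∀ s : Finset (Fin n), (∑ z : Fin n → V × V,
      if (Finset.univ.filter fun i => (z i).1 ≠ (z i).2) = s then ∏ i, κ (z i) else 0) =
        d ^ s.card * (1 - d) ^ (n - s.card) := by
    intro s
    have hs : ∀ z : Fin n → V × V, (Finset.univ.filter fun i => (z i).1 ≠ (z i).2) = s ↔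
        ∀ i, ((z i).1 ≠ (z i).2 ↔ i ∈ s) := fun z => by simp [Finset.ext_iff]
    simp only [hs]
    refine Eq.trans (by congr!)
      ((sum_pi_ite_prod (fun i w => w.1 ≠ w.2 ↔ i ∈ s) fun _ w => κ w).trans ?_)
    have hi : ∀ i, (∑ w : V × V, if (w.1 ≠ w.2 ↔ i ∈ s) then κ w else 0) =
        if i ∈ s then d else 1 - d := by
      intro i
      by_cases h : i ∈ s
      · simpa only [h, iff_true, if_true] using h2
      · simpa only [h, iff_false, not_not, if_false, ne_eq] using h1
    refine (Finset.prod_congr rfl fun i _ => Eq.trans (by congr!) (hi i)).trans ?_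
    rw [Finset.prod_ite, Finset.prod_const, Finset.prod_const, Finset.filter_not]
    simp [Finset.card_univ_sdiff]
  have hk : ∀ z : Fin n → V × V,
      (if (Finset.univ.filter fun i => (z i).1 ≠ (z i).2).card = k
        then ∏ i, κ (z i) else 0) = ∑ s ∈ Finset.powersetCard k Finset.univ,
        if (Finset.univ.filter fun i => (z i).1 ≠ (z i).2) = s then ∏ i, κ (z i) else 0 := by
    intro z
    rw [Finset.sum_ite_eq]
    simp [Finset.mem_powersetCard]
  rw [Finset.sum_congr rfl fun z _ => hk z, Finset.sum_comm,
    Finset.sum_congr rfl fun s _ => key s,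
    Finset.sum_congr rfl fun s hs => by rw [(Finset.mem_powersetCard.1 hs).2],
    Finset.sum_const, Finset.card_powersetCard, Finset.card_univ, Fintype.card_fin, binomPMF,
    nsmul_eq_mul, mul_assoc]

section JointLaw

variable {Ω A B C : Type*} [Fintype Ω]
  {K : Ω → ℝ} {f : Ω → A} {g : Ω → B} {h : Ω → C}

/-- The joint law of three functions under the weight `K`. -/
noncomputable def jointLaw (K : Ω → ℝ) (f : Ω → A) (g : Ω → B) (h : Ω → C) (w : A × B × C) : ℝ :=
  ∑ z, if f z = w.1 then if g z = w.2.1 then if h z = w.2.2 then K z else 0 else 0 else 0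

theorem jointLaw_nonneg (hK : ∀ z, 0 ≤ K z) (f : Ω → A) (g : Ω → B) (h : Ω → C)
    (w : A × B × C) : 0 ≤ jointLaw K f g h w := by
  refine Finset.sum_nonneg fun z _ => ?_
  split_ifs <;> first | exact hK z | exact le_rfl

theorem jointLaw_fst [Fintype B] [Fintype C] [DecidableEq A] (a : A) :
    (∑ b, ∑ c, jointLaw K f g h (a, b, c)) = ∑ z, if f z = a then K z else 0 := by
  simp only [jointLaw]
  rw [Finset.sum_congr rfl fun b _ => Finset.sum_comm, Finset.sum_comm]
  refine Finset.sum_congr rfl fun z _ => ?_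
  rw [Finset.sum_comm]
  by_cases hz : f z = a <;> simp [hz]

theorem jointLaw_snd [Fintype A] [Fintype C] [DecidableEq B] (b : B) :
    (∑ a, ∑ c, jointLaw K f g h (a, b, c)) = ∑ z, if g z = b then K z else 0 := by
  simp only [jointLaw]
  rw [Finset.sum_congr rfl fun a _ => Finset.sum_comm, Finset.sum_comm]
  refine Finset.sum_congr rfl fun z _ => ?_
  rw [Finset.sum_comm]
  by_cases hz : g z = b <;> simp [hz]

theorem jointLaw_trd [Fintype A] [Fintype B] [DecidableEq C] (c : C) :
    (∑ a, ∑ b, jointLaw K f g h (a, b, c)) = ∑ z, if h z = c then K z else 0 := by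
  simp only [jointLaw]
  rw [Finset.sum_congr rfl fun a _ => Finset.sum_comm, Finset.sum_comm]
  refine Finset.sum_congr rfl fun z _ => ?_
  rw [Finset.sum_comm]
  by_cases hz : h z = c <;> simp [hz]

theorem exists_of_jointLaw_ne_zero {a : A} {b : B} {c : C}
    (hw : jointLaw K f g h (a, b, c) ≠ 0) : ∃ z, f z = a ∧ g z = b ∧ h z = c := by
  obtain ⟨z, -, hz⟩ := Finset.exists_ne_zero_of_sum_ne_zero hw
  simp only [ne_eq, ite_eq_right_iff, not_forall] at hz
  obtain ⟨h₁, h₂, h₃, -⟩ := hz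
  exact ⟨z, h₁, h₂, h₃⟩

end JointLaw

theorem exists_coupling {n : ℕ} {p q : ℝ} (hp0 : 0 ≤ p) (hp1 : p ≤ 1) (hq0 : 0 ≤ q)
    (hq1 : q ≤ 1) :
    ∃ ν : (Fin n → Fin n → Bool) × (Fin n → Fin n → Bool) × Fin (n + 1) → ℝ,
      (∀ w, 0 ≤ ν w) ∧
      (∀ G, (∑ G', ∑ x, ν (G, G', x)) =
          if IsGraph G then erWeight (Matrix.of fun _ _ => p) G else 0) ∧
      (∀ G', (∑ G, ∑ x, ν (G, G', x)) =
          if IsGraph G' then erWeight (Matrix.of fun _ _ => q) G' else 0) ∧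
      (∀ x : Fin (n + 1), (∑ G, ∑ G', ν (G, G', x)) = binomPMF n (binomTV n p q) (x : ℕ)) ∧
      (∀ G G' (x : Fin (n + 1)), ν (G, G', x) ≠ 0 → nodeDist G G' ≤ (x : ℕ)) := by
  let κ : (Fin n → Bool) × (Fin n → Bool) → ℝ := maxCoupling (vecWeight p) (vecWeight q)
  have hsp := sum_vecWeight n p
  have hsq := sum_vecWeight n q
  have hκ : ∀ w, 0 ≤ κ w :=
    maxCoupling_nonneg (vecWeight_nonneg hp0 hp1) (vecWeight_nonneg hq0 hq1)
  let Ω := Fin n → (Fin n → Bool) × (Fin n → Bool)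
  let g₁ : Ω → Fin n → Fin n → Bool := fun z => upperGraph fun i => (z i).1
  let g₂ : Ω → Fin n → Fin n → Bool := fun z => upperGraph fun i => (z i).2
  let cnt : Ω → Fin (n + 1) := fun z =>
    ⟨(Finset.univ.filter fun i => (z i).1 ≠ (z i).2).card,
      Nat.lt_succ_of_le (by simpa using Finset.card_le_univ (α := Fin n) _)⟩
  let K : Ω → ℝ := fun z => ∏ i, κ (z i)
  have hK : ∀ z, 0 ≤ K z := fun z => Finset.prod_nonneg fun i _ => hκ (z i)
  refine ⟨jointLaw K g₁ g₂ cnt, jointLaw_nonneg hK g₁ g₂ cnt,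
    fun G => ?_, fun G' => ?_, fun x => ?_, fun G G' x h => ?_⟩
  · rw [jointLaw_fst, ← sum_upperGraph_eq]
    exact sum_prod_fst (sum_maxCoupling_right (hsp.trans hsq.symm)) fun x => upperGraph x = G
  · rw [jointLaw_snd, ← sum_upperGraph_eq]
    exact sum_prod_snd (sum_maxCoupling_left (hsp.trans hsq.symm)) fun x => upperGraph x = G'
  · rw [jointLaw_trd, ← sum_abs_vecWeight_sub, ← sum_prod_card_ne (sum_maxCoupling_eq hsp hsq)
      (sum_maxCoupling_ne hsp hsq)]
    simp only [Fin.ext_iff]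
    congr!
  · obtain ⟨z, rfl, rfl, rfl⟩ := exists_of_jointLaw_ne_zero h
    exact nodeDist_upperGraph_le _ _

theorem sum_binomPMF (n : ℕ) (p : ℝ) : ∑ k ∈ Finset.range (n + 1), binomPMF n p k = 1 := by
  have h := add_pow p (1 - p) n
  rw [add_sub_cancel, one_pow] at h
  rw [h]
  exact Finset.sum_congr rfl fun k _ => by unfold binomPMF; ring

theorem binomPMF_pos {n k : ℕ} {p : ℝ} (h0 : 0 < p) (h1 : p < 1) (hk : k ≤ n) :
    0 < binomPMF n p k :=
  mul_pos (mul_pos (Nat.cast_pos.2 (Nat.choose_pos hk)) (pow_pos h0 _))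
    (pow_pos (sub_pos.2 h1) _)

/-- The chi-squared divergence between two binomial distributions. -/
theorem sum_sq_binomPMF_sub_div {n : ℕ} {p q : ℝ} (h0 : 0 < p) (h1 : p < 1) :
    ∑ k ∈ Finset.range (n + 1), (binomPMF n p k - binomPMF n q k) ^ 2 / binomPMF n p k =
      (1 + (p - q) ^ 2 / (p * (1 - p))) ^ n - 1 := by
  have h1' : 0 < 1 - p := sub_pos.2 h1
  have hbase : 1 + (p - q) ^ 2 / (p * (1 - p)) = q ^ 2 / p + (1 - q) ^ 2 / (1 - p) := by
    field_simp
    ring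
  have hterm : ∀ k ∈ Finset.range (n + 1),
      (binomPMF n p k - binomPMF n q k) ^ 2 / binomPMF n p k =
        (q ^ 2 / p) ^ k * ((1 - q) ^ 2 / (1 - p)) ^ (n - k) * (n.choose k : ℝ) +
          (binomPMF n p k - 2 * binomPMF n q k) := by
    intro k hk
    have hk' : k ≤ n := Nat.lt_succ_iff.1 (Finset.mem_range.1 hk)
    have hpos := binomPMF_pos h0 h1 hk'
    have hc : (0 : ℝ) < n.choose k := Nat.cast_pos.2 (Nat.choose_pos hk')
    have hsq : (q ^ 2 / p) ^ k * ((1 - q) ^ 2 / (1 - p)) ^ (n - k) * (n.choose k : ℝ) =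
        binomPMF n q k ^ 2 / binomPMF n p k := by
      unfold binomPMF
      rw [div_pow, div_pow, ← pow_mul, ← pow_mul]
      field_simp
      ring
    rw [hsq]
    field_simp
    ring
  rw [Finset.sum_congr rfl hterm, Finset.sum_add_distrib, Finset.sum_sub_distrib,
    ← Finset.mul_sum, sum_binomPMF, sum_binomPMF, hbase, add_pow]
  ring

theorem binomTV_sq_le {n : ℕ} {p q : ℝ} (h0 : 0 < p) (h1 : p < 1) :
    (2 * binomTV n p q) ^ 2 ≤ (1 + (p - q) ^ 2 / (p * (1 - p))) ^ n - 1 := by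
  have h := Finset.sq_sum_div_le_sum_sq_div (Finset.range (n + 1))
    (fun k => |binomPMF n p k - binomPMF n q k|) (g := binomPMF n p)
    fun k hk => binomPMF_pos h0 h1 (Nat.lt_succ_iff.1 (Finset.mem_range.1 hk))
  simp only [sq_abs, sum_binomPMF, div_one, sum_sq_binomPMF_sub_div h0 h1] at h
  rwa [binomTV, mul_div_cancel₀ _ (two_ne_zero' ℝ)]

theorem binomTV_self (n : ℕ) (p : ℝ) : binomTV n p p = 0 := by
  simp [binomTV]

theorem binomTV_le {n : ℕ} {p α : ℝ} (h0 : 0 ≤ p) (hα : 0 ≤ α) (hp : p ≤ 1 / 2)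
    (hc : α ≤ 1 / 4 / √(n * p)) :
    binomTV n p ((1 - 2 * α) * p) ≤ 2 * α * √(n * p) := by
  rcases eq_or_lt_of_le (Real.sqrt_nonneg ((n : ℝ) * p)) with hs | hs
  · rw [← hs, div_zero] at hc
    obtain rfl : α = 0 := le_antisymm hc hα
    simp [binomTV_self]
  have hnp : 0 < n * p := Real.sqrt_pos.1 hs
  have hp0 : 0 < p := h0.lt_of_ne (by rintro rfl; simp at hnp)
  rw [le_div_iff₀ hs] at hc
  have hsq : (α * √(n * p)) ^ 2 = α ^ 2 * (n * p) := by rw [mul_pow, Real.sq_sqrt hnp.le]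
  have ht : α ^ 2 * (n * p) ≤ 1 / 16 := by
    rw [← hsq]
    nlinarith [mul_nonneg hα hs.le]
  have hbase : 1 + (p - (1 - 2 * α) * p) ^ 2 / (p * (1 - p)) ≤ Real.exp (8 * α ^ 2 * p) := by
    refine le_trans ?_ (Real.add_one_le_exp _)
    have : (p - (1 - 2 * α) * p) ^ 2 / (p * (1 - p)) ≤ 8 * α ^ 2 * p := by
      rw [div_le_iff₀ (mul_pos hp0 (by linarith))]
      have : 0 ≤ α ^ 2 * p ^ 2 * (1 - 2 * p) :=
        mul_nonneg (by positivity) (by linarith)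
      nlinarith
    linarith
  have hpow : (1 + (p - (1 - 2 * α) * p) ^ 2 / (p * (1 - p))) ^ n ≤
      Real.exp (8 * (α ^ 2 * (n * p))) := by
    refine (pow_le_pow_left₀ ?_ hbase n).trans_eq ?_
    · have : 0 < 1 - p := by linarith
      positivity
    · rw [← Real.exp_nat_mul]
      ring_nf
  have hexp : Real.exp (8 * (α ^ 2 * (n * p))) - 1 ≤ 16 * (α ^ 2 * (n * p)) := by
    have ht0 : 0 ≤ α ^ 2 * (n * p) := by positivity
    have h := Real.abs_exp_sub_one_le (x := 8 * (α ^ 2 * (n * p)))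
      (by rw [abs_of_nonneg (by positivity)]; linarith)
    rw [abs_of_nonneg (a := 8 * (α ^ 2 * (n * p))) (by positivity)] at h
    linarith [le_abs_self (Real.exp (8 * (α ^ 2 * (n * p))) - 1)]
  have hTV := binomTV_sq_le (n := n) (q := (1 - 2 * α) * p) hp0 (by linarith)
  have hfin : (2 * binomTV n p ((1 - 2 * α) * p)) ^ 2 ≤ (4 * (α * √(n * p))) ^ 2 := by
    rw [mul_pow 4, hsq]
    linarith
  have := abs_le_of_sq_le_sq' hfin (by positivity)
  linarith [this.2]

/-- coupling of `G(n,p°)` and `G(n,(1-2α)p°)`.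
The coupling `ν` is a joint distribution on pairs of graphs together with a
random variable `X ~ Bin(n, Δ)` (with values in `{0, …, n}`) such that
`dist(G,G') ≤ X` almost surely.  Moreover, for absolute constants `c, c', C`,
if `p° ≤ c` and `α ≤ c'/√(n·p°)` then `Δ ≤ C·α·√(n·p°)`. -/
theorem coupling :
    (∀ (n : ℕ) (p α : ℝ), 0 ≤ p → p ≤ 1 → 0 ≤ α → α ≤ 1 / 2 →
      ∃ ν : (Fin n → Fin n → Bool) × (Fin n → Fin n → Bool) × Fin (n + 1) → ℝ,
        (∀ w, 0 ≤ ν w) ∧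
        (∀ G, (∑ G', ∑ x, ν (G, G', x)) =
            if IsGraph G then erWeight (Matrix.of fun _ _ => p) G else 0) ∧
        (∀ G', (∑ G, ∑ x, ν (G, G', x)) =
            if IsGraph G' then erWeight (Matrix.of fun _ _ => (1 - 2 * α) * p) G'
            else 0) ∧
        (∀ x : Fin (n + 1), (∑ G, ∑ G', ν (G, G', x)) =
            binomPMF n (binomTV n p ((1 - 2 * α) * p)) (x : ℕ)) ∧
        (∀ G G' (x : Fin (n + 1)), ν (G, G', x) ≠ 0 → nodeDist G G' ≤ (x : ℕ)))
    ∧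
    (∃ c > (0 : ℝ), ∃ c' > (0 : ℝ), ∃ C > (0 : ℝ), ∀ (n : ℕ) (p α : ℝ),
      0 ≤ p → p ≤ 1 → 0 ≤ α → α ≤ 1 / 2 →
      p ≤ c → α ≤ c' / Real.sqrt (n * p) →
      binomTV n p ((1 - 2 * α) * p) ≤ C * α * Real.sqrt (n * p)) := by
  refine ⟨fun n p α h0 h1 hα hα' => ?_, 1 / 2, by norm_num, 1 / 4, by norm_num, 2, by norm_num,
    fun n p α h0 _ hα _ hp hc => binomTV_le h0 hα hp hc⟩
  exact exists_coupling h0 h1 (mul_nonneg (by linarith) h0) (mul_le_one₀ (by linarith) h0 h1)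

end EdgeDensity
end

section
/- Let 𝒜 be an ε-differentially node-private randomized algorithm on n-node graphs. Let D and D' be probability distributions over n-node graphs, and suppose there is a coupling ω of D and D' together with a random variable X distributed as Bin(n,Δ) on the same probability space such that dist(G,G') ≤ X almost surely for (G,G') ~ ω. Let S ⊆ ℝ be a measurable set and β ∈ (0,1) be such that Pr_{G'~D'}[𝒜(G') ∈ S] ≥ 1−β and Pr_{G~D}[𝒜(G) ∈ S] ≤ β. Then (1−β)² ≤ exp(n·Δ·(e^{2ε}−1))·β. -/
open scoped BigOperators Classical

namespace EdgeDensity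

lemma nodeDist_le_card {n : ℕ} {A B : Fin n → Fin n → Bool} (T : Finset (Fin n))
    (h : ∀ i j, i ∉ T → j ∉ T → A i j = B i j) : nodeDist A B ≤ T.card :=
  Nat.sInf_le ⟨T, rfl, h⟩

lemma exists_card_eq_nodeDist {n : ℕ} (A B : Fin n → Fin n → Bool) :
    ∃ T : Finset (Fin n), T.card = nodeDist A B ∧
      ∀ i j, i ∉ T → j ∉ T → A i j = B i j :=
  Nat.sInf_mem (s := {k | ∃ S : Finset (Fin n), S.card = k ∧
    ∀ i j, i ∉ S → j ∉ S → A i j = B i j})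
    ⟨_, Finset.univ, rfl, fun i _ hi _ => absurd (Finset.mem_univ i) hi⟩

/-- Group privacy for graphs that agree outside a set `T` of nodes. -/
lemma IsNodeDP.measureReal_le_of_agree {n : ℕ} {ε : ℝ}
    {𝒜 : (Fin n → Fin n → Bool) → MeasureTheory.Measure ℝ}
    (hprob : ∀ G, MeasureTheory.IsProbabilityMeasure (𝒜 G)) (hDP : IsNodeDP ε 𝒜)
    {S : Set ℝ} (hS : MeasurableSet S) {A : Fin n → Fin n → Bool} (hA : IsGraph A)
    (T : Finset (Fin n)) :
    ∀ B, IsGraph B → (∀ i j, i ∉ T → j ∉ T → A i j = B i j) →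
      (𝒜 A S).toReal ≤ Real.exp ε ^ T.card * (𝒜 B S).toReal := by
  induction T using Finset.induction_on with
  | empty =>
    intro B _ h
    have hAB : A = B := by
      funext i j
      exact h i j (by simp) (by simp)
    simp [hAB]
  | insert v T hv ih =>
    intro B hB h
    set H : Fin n → Fin n → Bool := fun i j => if i = v ∨ j = v then A i j else B i j with hH
    have hHg : IsGraph H := by
      refine ⟨fun i j => ?_, fun i => ?_⟩
      · simp only [hH, or_comm (a := i = v), hA.1 i j, hB.1 i j]
      · simp only [hH, hA.2, hB.2, ite_self]
    have hAH : ∀ i j, i ∉ T → j ∉ T → A i j = H i j := by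
      intro i j hi hj
      by_cases hij : i = v ∨ j = v
      · simp only [hH, if_pos hij]
      · simp only [hH, if_neg hij]
        push Not at hij
        exact h i j (by simp [hij.1, hi]) (by simp [hij.2, hj])
    have hHB : nodeDist H B ≤ 1 := by
      refine (nodeDist_le_card {v} fun i j hi hj => ?_).trans_eq (Finset.card_singleton v)
      simp only [Finset.mem_singleton] at hi hj
      simp [hH, hi, hj]
    have hstep : (𝒜 H S).toReal ≤ Real.exp ε * (𝒜 B S).toReal := by
      have := ENNReal.toReal_mono
        (ENNReal.mul_ne_top ENNReal.ofReal_ne_top (MeasureTheory.measure_ne_top (𝒜 B) S))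
        (hDP H B hHg hB hHB S hS)
      rwa [ENNReal.toReal_mul, ENNReal.toReal_ofReal (Real.exp_pos ε).le] at this
    calc (𝒜 A S).toReal ≤ Real.exp ε ^ T.card * (𝒜 H S).toReal := ih H hHg hAH
      _ ≤ Real.exp ε ^ T.card * (Real.exp ε * (𝒜 B S).toReal) := by gcongr
      _ = Real.exp ε ^ (insert v T).card * (𝒜 B S).toReal := by
        rw [Finset.card_insert_of_notMem hv]; ring

lemma nodeDist_comm {n : ℕ} (A B : Fin n → Fin n → Bool) : nodeDist A B = nodeDist B A := by
  simp only [nodeDist, eq_comm (a := A _ _)]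

/-- Group privacy: graphs at node distance at most `k` have output probabilities
within a factor `exp ε ^ k`. -/
lemma IsNodeDP.measureReal_le {n : ℕ} {ε : ℝ} (hε : 0 ≤ ε)
    {𝒜 : (Fin n → Fin n → Bool) → MeasureTheory.Measure ℝ}
    (hprob : ∀ G, MeasureTheory.IsProbabilityMeasure (𝒜 G)) (hDP : IsNodeDP ε 𝒜)
    {S : Set ℝ} (hS : MeasurableSet S) {A B : Fin n → Fin n → Bool} (hA : IsGraph A)
    (hB : IsGraph B) {k : ℕ} (hk : nodeDist A B ≤ k) :
    (𝒜 A S).toReal ≤ Real.exp ε ^ k * (𝒜 B S).toReal := by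
  obtain ⟨T, hT, h⟩ := exists_card_eq_nodeDist A B
  refine (hDP.measureReal_le_of_agree hprob hS hA T B hB h).trans ?_
  gcongr
  · exact Real.one_le_exp hε
  · exact hT.trans_le hk

/-- The probability generating function of the binomial distribution. -/
lemma sum_binomPMF_mul_pow (n : ℕ) (p t : ℝ) :
    ∑ x : Fin (n + 1), binomPMF n p x * t ^ (x : ℕ) = (1 + p * (t - 1)) ^ n := by
  rw [Fin.sum_univ_eq_sum_range (fun k => binomPMF n p k * t ^ k),
    show 1 + p * (t - 1) = p * t + (1 - p) by ring, add_pow]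
  refine Finset.sum_congr rfl fun k _ => ?_
  rw [binomPMF, mul_pow]
  ring

/-- a coupled pair of distributions cannot be distinguished by
a differentially node-private algorithm. -/
theorem dp_coupling_bound (n : ℕ) (ε Δ β : ℝ)
    (hε : 0 ≤ ε) (hΔ0 : 0 ≤ Δ) (hΔ1 : Δ ≤ 1) (hβ0 : 0 < β) (hβ1 : β < 1)
    (𝒜 : (Fin n → Fin n → Bool) → MeasureTheory.Measure ℝ)
    (hprob : ∀ G, MeasureTheory.IsProbabilityMeasure (𝒜 G))
    (hDP : IsNodeDP ε 𝒜)
    (D D' : (Fin n → Fin n → Bool) → ℝ)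
    (hD0 : ∀ G, 0 ≤ D G) (hD'0 : ∀ G, 0 ≤ D' G)
    (hD1 : (∑ G, D G) = 1) (hD'1 : (∑ G', D' G') = 1)
    (hDsupp : ∀ G, D G ≠ 0 → IsGraph G) (hD'supp : ∀ G', D' G' ≠ 0 → IsGraph G')
    (ν : (Fin n → Fin n → Bool) × (Fin n → Fin n → Bool) × Fin (n + 1) → ℝ)
    (hν0 : ∀ w, 0 ≤ ν w)
    (hm1 : ∀ G, (∑ G', ∑ x, ν (G, G', x)) = D G)
    (hm2 : ∀ G', (∑ G, ∑ x, ν (G, G', x)) = D' G')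
    (hm3 : ∀ x : Fin (n + 1), (∑ G, ∑ G', ν (G, G', x)) = binomPMF n Δ (x : ℕ))
    (hsupp : ∀ G G' (x : Fin (n + 1)), ν (G, G', x) ≠ 0 → nodeDist G G' ≤ (x : ℕ))
    (S : Set ℝ) (hS : MeasurableSet S)
    (h1 : 1 - β ≤ ∑ G', D' G' * ((𝒜 G') S).toReal)
    (h2 : (∑ G, D G * ((𝒜 G) S).toReal) ≤ β) :
    (1 - β) ^ 2 ≤ Real.exp (n * Δ * (Real.exp (2 * ε) - 1)) * β := by
  set a : (Fin n → Fin n → Bool) → ℝ := fun G => (𝒜 G S).toReal with ha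
  have ha0 : ∀ G, 0 ≤ a G := fun G => ENNReal.toReal_nonneg
  have ha1 : ∀ G, a G ≤ 1 := fun G => by
    have := hprob G
    exact MeasureTheory.measureReal_le_one
  have hgraph₁ : ∀ G G' x, ν (G, G', x) ≠ 0 → IsGraph G := by
    intro G G' x hν
    refine hDsupp G fun h0 => hν ?_
    rw [← hm1 G, Finset.sum_eq_zero_iff_of_nonneg
      fun _ _ => Finset.sum_nonneg fun _ _ => hν0 _] at h0
    exact (Finset.sum_eq_zero_iff_of_nonneg fun _ _ => hν0 _).1 (h0 G' (Finset.mem_univ _)) x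
      (Finset.mem_univ _)
  have hgraph₂ : ∀ G G' x, ν (G, G', x) ≠ 0 → IsGraph G' := by
    intro G G' x hν
    refine hD'supp G' fun h0 => hν ?_
    rw [← hm2 G', Finset.sum_eq_zero_iff_of_nonneg
      fun _ _ => Finset.sum_nonneg fun _ _ => hν0 _] at h0
    exact (Finset.sum_eq_zero_iff_of_nonneg fun _ _ => hν0 _).1 (h0 G (Finset.mem_univ _)) x
      (Finset.mem_univ _)
  have hD' : ∑ G', D' G' * a G' = ∑ w, ν w * a w.2.1 := by
    simp only [Fintype.sum_prod_type, ← hm2, Finset.sum_mul]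
    exact Finset.sum_comm
  have hD : ∑ G, D G * a G = ∑ w, ν w * a w.1 := by
    simp only [Fintype.sum_prod_type, ← hm1, Finset.sum_mul]
  have hX : ∑ w, ν w * (Real.exp ε ^ (w.2.2 : ℕ)) ^ 2
      = (1 + Δ * (Real.exp (2 * ε) - 1)) ^ n := by
    rw [← sum_binomPMF_mul_pow]
    simp only [Fintype.sum_prod_type, ← hm3, Finset.sum_mul]
    rw [Finset.sum_comm (γ := Fin (n + 1))]
    refine Finset.sum_congr rfl fun G _ => ?_
    rw [Finset.sum_comm (γ := Fin (n + 1))]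
    refine Finset.sum_congr rfl fun G' _ => Finset.sum_congr rfl fun x _ => ?_
    rw [← pow_mul, mul_comm _ 2, pow_mul, ← Real.exp_nat_mul, Nat.cast_ofNat]
  have hpriv : ∑ w, ν w * a w.2.1 ≤ ∑ w, ν w * (Real.exp ε ^ (w.2.2 : ℕ) * a w.1) := by
    refine Finset.sum_le_sum fun ⟨G, G', x⟩ _ => ?_
    by_cases hν : ν (G, G', x) = 0
    · simp [hν]
    · exact mul_le_mul_of_nonneg_left
        (hDP.measureReal_le hε hprob hS (hgraph₂ G G' x hν) (hgraph₁ G G' x hν)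
          ((nodeDist_comm G' G).trans_le (hsupp G G' x hν))) (hν0 _)
  have hCS : (∑ w, ν w * (Real.exp ε ^ (w.2.2 : ℕ) * a w.1)) ^ 2
      ≤ (∑ w, ν w * (Real.exp ε ^ (w.2.2 : ℕ)) ^ 2) * ∑ w, ν w * a w.1 ^ 2 := by
    refine Finset.sum_sq_le_sum_mul_sum_of_sq_le_mul _ (fun w _ => ?_) (fun w _ => ?_)
      fun w _ => by apply le_of_eq; ring
    · exact mul_nonneg (hν0 w) (sq_nonneg _)
    · exact mul_nonneg (hν0 w) (sq_nonneg _)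
  have hsq : ∑ w, ν w * a w.1 ^ 2 ≤ β := by
    refine (Finset.sum_le_sum fun w _ => mul_le_mul_of_nonneg_left ?_ (hν0 w)).trans
      (hD.symm.trans_le h2)
    exact pow_le_of_le_one (ha0 _) (ha1 _) two_ne_zero
  have hexp : (1 + Δ * (Real.exp (2 * ε) - 1)) ^ n
      ≤ Real.exp (n * Δ * (Real.exp (2 * ε) - 1)) := by
    have h0 : 0 ≤ Δ * (Real.exp (2 * ε) - 1) :=
      mul_nonneg hΔ0 (sub_nonneg.2 (Real.one_le_exp (by positivity)))
    rw [mul_assoc, Real.exp_nat_mul]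
    refine pow_le_pow_left₀ (by positivity) ?_ n
    rw [add_comm]
    exact Real.add_one_le_exp _
  calc (1 - β) ^ 2 ≤ (∑ w, ν w * (Real.exp ε ^ (w.2.2 : ℕ) * a w.1)) ^ 2 :=
        pow_le_pow_left₀ (sub_nonneg.2 hβ1.le) (h1.trans (hD'.trans_le hpriv)) 2
    _ ≤ _ := hCS
    _ ≤ Real.exp (n * Δ * (Real.exp (2 * ε) - 1)) * β := by
        rw [hX]
        exact mul_le_mul hexp hsq
          (Finset.sum_nonneg fun w _ => mul_nonneg (hν0 w) (sq_nonneg _)) (Real.exp_pos _).le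

end EdgeDensity
end

section
/- Let n ∈ ℕ, let A ∈ ℝ^{n×n} be symmetric, let σ ≥ 0, and let γ, γ* ∈ [0,1] satisfy 1 − 2γσ − 2γ*σ > 0. Suppose there exists a pair (A*, z*) satisfying the feasibility constraints P1(A, γ*) such that (A*·𝟙)_i ≤ σ·d(A*) for all i. Then every pair (Y, z) satisfying P1(A, γ) with (Y·𝟙)_i ≤ σ·d(Y) for all i obeys (1 − 2γσ − 2γ*σ)·d(A*) ≤ d(Y) ≤ d(A*)/(1 − 2γσ − 2γ*σ). -/
open scoped BigOperators Classical

namespace EdgeDensity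

/-- If two nonnegative matrices agree on every entry whose row and column both avoid the support
of the weights `w`, and the first is symmetric with row sums at most `σ` times their average, then
the average row sum of the second is at least a `1 - 2 β σ` fraction of that of the first, where
`β` bounds the average weight. -/
theorem dbar_lower_bound {n : ℕ} {X Y : Matrix (Fin n) (Fin n) ℝ} {w : Fin n → ℝ} {σ β : ℝ}
    (hσ : 0 ≤ σ) (hsymm : ∀ i j, X i j = X j i) (hX : ∀ i j, 0 ≤ X i j)
    (hY : ∀ i j, 0 ≤ Y i j) (hw : ∀ i, w i = 0 ∨ 1 ≤ w i) (hwsum : ∑ i, w i ≤ β * n)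
    (hXY : ∀ i j, w i = 0 → w j = 0 → X i j = Y i j)
    (hdeg : ∀ i, rowSum X i ≤ σ * dbar X) :
    (1 - 2 * β * σ) * dbar X ≤ dbar Y := by
  rcases Nat.eq_zero_or_pos n with rfl | hn
  · simp [dbar]
  have hn' : (0 : ℝ) < n := Nat.cast_pos.mpr hn
  have hw0 : ∀ i, 0 ≤ w i := fun i => by rcases hw i with h | h <;> linarith
  have hd : 0 ≤ dbar X :=
    div_nonneg (Finset.sum_nonneg fun i _ => Finset.sum_nonneg fun j _ => hX i j) hn'.le
  have hpt : ∀ i j, X i j ≤ Y i j + w i * X i j + w j * X i j := fun i j => by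
    have hi := mul_nonneg (hw0 i) (hX i j)
    have hj := mul_nonneg (hw0 j) (hX i j)
    rcases hw i with h | h
    · rcases hw j with h' | h'
      · linarith [hXY i j h h']
      · linarith [hY i j, le_mul_of_one_le_left (hX i j) h']
    · linarith [hY i j, le_mul_of_one_le_left (hX i j) h]
  have hrow : ∑ i, ∑ j, w i * X i j ≤ β * n * (σ * dbar X) := by
    calc ∑ i, ∑ j, w i * X i j = ∑ i, w i * rowSum X i := by simp only [rowSum, Finset.mul_sum]
      _ ≤ ∑ i, w i * (σ * dbar X) :=
        Finset.sum_le_sum fun i _ => mul_le_mul_of_nonneg_left (hdeg i) (hw0 i)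
      _ = (∑ i, w i) * (σ * dbar X) := (Finset.sum_mul ..).symm
      _ ≤ β * n * (σ * dbar X) := mul_le_mul_of_nonneg_right hwsum (mul_nonneg hσ hd)
  have hcol : ∑ i, ∑ j, w j * X i j = ∑ i, ∑ j, w i * X i j := by
    rw [Finset.sum_comm]
    exact Finset.sum_congr rfl fun i _ => Finset.sum_congr rfl fun j _ => by rw [hsymm j i]
  have hsum : ∑ i, ∑ j, X i j ≤
      ∑ i, ∑ j, Y i j + ∑ i, ∑ j, w i * X i j + ∑ i, ∑ j, w j * X i j := by
    simp only [← Finset.sum_add_distrib]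
    exact Finset.sum_le_sum fun i _ => Finset.sum_le_sum fun j _ => hpt i j
  have hXd : ∑ i, ∑ j, X i j = dbar X * n := (div_mul_cancel₀ _ hn'.ne').symm
  have hYd : ∑ i, ∑ j, Y i j = dbar Y * n := (div_mul_cancel₀ _ hn'.ne').symm
  refine le_of_mul_le_mul_right ?_ hn'
  linarith

/-- The one-sided comparison of the densities of two matrices feasible for the same input. -/
theorem P1.dbar_le {n : ℕ} {A X Y : Matrix (Fin n) (Fin n) ℝ} {x y : Fin n → ℝ} {σ α β : ℝ}
    (hσ : 0 ≤ σ) (hX : P1 A α X x) (hY : P1 A β Y y) (hdeg : ∀ i, rowSum X i ≤ σ * dbar X) :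
    (1 - 2 * (α + β) * σ) * dbar X ≤ dbar Y := by
  obtain ⟨hx, hxsum, hXsymm, hX01, hXA⟩ := hX
  obtain ⟨hy, hysum, -, hY01, hYA⟩ := hY
  refine dbar_lower_bound (w := fun i => (1 - x i) + (1 - y i)) hσ hXsymm
    (fun i j => (hX01 i j).1) (fun i j => (hY01 i j).1) (fun i => ?_) ?_ (fun i j hi hj => ?_) hdeg
  · rcases hx i with h | h <;> rcases hy i with h' | h' <;> norm_num [h, h']
  · simp only [Finset.sum_add_distrib, Finset.sum_sub_distrib, Finset.sum_const, Finset.card_univ,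
      Fintype.card_fin, nsmul_eq_mul, mul_one]
    linarith
  · have one : ∀ k, (1 - x k) + (1 - y k) = 0 → x k = 1 ∧ y k = 1 := fun k hk => by
      rcases hx k with h | h <;> rcases hy k with h' | h' <;> constructor <;> linarith
    have hXij := hXA i j
    have hYij := hYA i j
    rw [(one i hi).1, (one j hj).1] at hXij
    rw [(one i hi).2, (one j hj).2] at hYij
    linarith

/-- coarse identifiability under the degree-bound
constraints. -/
theorem coarse_identifiability (n : ℕ) (A : Matrix (Fin n) (Fin n) ℝ)
    (hA : ∀ i j, A i j = A j i)
    (σ γ γs : ℝ) (hσ : 0 ≤ σ)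
    (hγ0 : 0 ≤ γ) (hγ1 : γ ≤ 1) (hγs0 : 0 ≤ γs) (hγs1 : γs ≤ 1)
    (hpos : 0 < 1 - 2 * γ * σ - 2 * γs * σ)
    (Astar : Matrix (Fin n) (Fin n) ℝ) (zstar : Fin n → ℝ)
    (hfeas : P1 A γs Astar zstar)
    (hdeg : ∀ i, rowSum Astar i ≤ σ * dbar Astar)
    (Y : Matrix (Fin n) (Fin n) ℝ) (z : Fin n → ℝ)
    (hY : P1 A γ Y z)
    (hYdeg : ∀ i, rowSum Y i ≤ σ * dbar Y) :
    (1 - 2 * γ * σ - 2 * γs * σ) * dbar Astar ≤ dbar Y ∧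
      dbar Y ≤ dbar Astar / (1 - 2 * γ * σ - 2 * γs * σ) := by
  have hlower := hfeas.dbar_le hσ hY hdeg
  have hupper := hY.dbar_le hσ hfeas hYdeg
  rw [le_div_iff₀ hpos]
  constructor <;> linarith

end EdgeDensity
end
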